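/- Let p be an odd prime, q = p^n, and r ≥ 3 an integer such that GL_2(F_q) contains an element of order 2^r. If q ≡ 2^{r−1} − 1 (mod 2^r), then K_{2^r}(GL_2(F_q)) = ℚ(ζ_{2^{r−1}} + ζ_{2^{r−1}}^{−1}, ζ_{2^r} − ζ_{2^r}^{−1}); if q ≡ 2^{r−1} + 1 (mod 2^r), then K_{2^r}(GL_2(F_q)) = ℚ(ζ_{2^{r−1}}). -/

import Mathlib

open CategoryTheory

/-- `zeta N` is the root of unity `e^{2 π i / N}`. -/
noncomputable def zeta (N : ℕ) : ℂ := Complex.exp (2 * Real.pi * Complex.I / N)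

/-- `charField G` is the field `K(G)` generated over `ℚ` by all values of
irreducible complex characters of `G`. -/
noncomputable def charField (G : Type) [Group G] : IntermediateField ℚ ℂ :=
  IntermediateField.adjoin ℚ
    {x : ℂ | ∃ V : FDRep ℂ G, Simple V ∧ ∃ g : G, V.character g = x}

/-- `charFieldAt G d` is the field `K_d(G)` generated over `ℚ` by the values of
irreducible complex characters of `G` at elements of order exactly `d`. -/
noncomputable def charFieldAt (G : Type) [Group G] (d : ℕ) : IntermediateField ℚ ℂ :=
  IntermediateField.adjoin ℚ
    {x : ℂ | ∃ V : FDRep ℂ G, Simple V ∧ ∃ g : G, orderOf g = d ∧ V.character g = x}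

/-- The trace of an endomorphism preserving two complementary subspaces is the sum of the traces
of its restrictions. -/
theorem LinearMap.trace_eq_add_trace_restrict_of_isCompl {K V : Type*} [Field K] [AddCommGroup V]
    [Module K V] [FiniteDimensional K V] {W W' : Submodule K V} (h : IsCompl W W')
    (f : V →ₗ[K] V) (hW : ∀ x ∈ W, f x ∈ W) (hW' : ∀ x ∈ W', f x ∈ W') :
    LinearMap.trace K V f =
      LinearMap.trace K W (f.restrict hW) + LinearMap.trace K W' (f.restrict hW') := by
  have hint : DirectSum.IsInternal (fun b : Bool => cond b W W') :=
    (DirectSum.isInternal_submodule_iff_isCompl _ (i := true) (j := false) (by simp)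
      (by ext b; cases b <;> simp)).2 h
  have hmaps : ∀ b : Bool, Set.MapsTo f (cond b W W' : Submodule K V)
      (cond b W W' : Submodule K V) := by
    rintro (_ | _)
    · exact hW'
    · exact hW
  rw [LinearMap.trace_eq_sum_trace_restrict hint hmaps, Fintype.sum_bool]
  rfl

/-- An irreducible representation of a finite group over `ℂ` is a simple object of `FDRep`. -/
theorem Representation.simple_fdRep_of {G V : Type} [Group G] [Finite G] [AddCommGroup V]
    [Module ℂ V] [FiniteDimensional ℂ V] (ρ : Representation ℂ G V) [ρ.IsIrreducible] :
    Simple (FDRep.of ρ) := by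
  have := Fintype.ofFinite G
  have := invertibleOfNonzero (NeZero.ne (Nat.card G : ℂ))
  have h := Representation.char_orthonormal ρ ρ
  rw [if_pos ⟨Representation.Equiv.refl ρ⟩, inv_mul_eq_one₀ (NeZero.ne _)] at h
  exact (FDRep.simple_iff_char_is_norm_one _).2 h.symm

/-- The character values of an arbitrary finite-dimensional representation at elements of order
`d` lie in the field generated by those of the irreducible ones. -/
theorem Representation.character_mem_charFieldAt {G V : Type} [Group G] [Finite G]
    [AddCommGroup V] [Module ℂ V] [FiniteDimensional ℂ V] (ρ : Representation ℂ G V) {d : ℕ}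
    {g : G} (hg : orderOf g = d) : ρ.character g ∈ charFieldAt G d := by
  induction hn : Module.finrank ℂ V using Nat.strong_induction_on generalizing V with
  | _ n ih =>
  rcases subsingleton_or_nontrivial V with hV | hV
  · rw [Representation.character, Subsingleton.elim (ρ g) 0, map_zero]
    exact zero_mem _
  by_cases hirr : ρ.IsIrreducible
  · exact IntermediateField.subset_adjoin _ _
      ⟨FDRep.of ρ, ρ.simple_fdRep_of, g, hg, rfl⟩
  have hnt : Nontrivial (Subrepresentation ρ) := by
    refine ⟨⊥, ⊤, fun h => ?_⟩
    exact bot_ne_top (α := Submodule ℂ V) (congrArg Subrepresentation.toSubmodule h)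
  obtain ⟨W, hbot, htop⟩ : ∃ W : Subrepresentation ρ, W ≠ ⊥ ∧ W ≠ ⊤ := by
    by_contra! h
    exact hirr ⟨fun W => or_iff_not_imp_left.2 (h W)⟩
  obtain ⟨W', hW'⟩ := exists_isCompl W
  have hc : IsCompl W.toSubmodule W'.toSubmodule := by
    constructor
    · rw [disjoint_iff, ← Subrepresentation.toSubmodule_inf, hW'.inf_eq_bot]; rfl
    · rw [codisjoint_iff, ← Subrepresentation.toSubmodule_sup, hW'.sup_eq_top]; rfl
  have hadd := Submodule.finrank_add_eq_of_isCompl hc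
  have hW0 : 0 < Module.finrank ℂ W.toSubmodule := by
    rw [Nat.pos_iff_ne_zero, Ne, Submodule.finrank_eq_zero]
    exact fun h => hbot (Subrepresentation.toSubmodule_injective h)
  have hWn : Module.finrank ℂ W.toSubmodule < Module.finrank ℂ V :=
    Submodule.finrank_lt fun h => htop (Subrepresentation.toSubmodule_injective h)
  rw [Representation.character, LinearMap.trace_eq_add_trace_restrict_of_isCompl hc (ρ g)
    (W.apply_mem_toSubmodule g) (W'.apply_mem_toSubmodule g)]
  exact add_mem (ih _ (by omega) W.toRepresentation rfl)
    (ih _ (by omega) W'.toRepresentation rfl)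

/-- The average of the first `N` powers of `U`; for `U ^ N = 1` it is the projection onto the
fixed points of `U`. -/
noncomputable def powAverage {A : Type*} [Ring A] [Algebra ℂ A] (N : ℕ) (U : A) : A :=
  (N : ℂ)⁻¹ • ∑ j ∈ Finset.range N, U ^ j

section powAverage

variable {A : Type*} [Ring A] [Algebra ℂ A] {N : ℕ} {U : A}

theorem mul_powAverage (hU : U ^ N = 1) : U * powAverage N U = powAverage N U := by
  rw [← sub_eq_zero, ← sub_one_mul, powAverage, mul_smul_comm, mul_geom_sum, hU, sub_self,
    smul_zero]

theorem pow_mul_powAverage (hU : U ^ N = 1) (m : ℕ) : U ^ m * powAverage N U = powAverage N U := by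
  induction m with
  | zero => simp
  | succ m ih => rw [pow_succ, mul_assoc, mul_powAverage hU, ih]

theorem isIdempotentElem_powAverage (hN : N ≠ 0) (hU : U ^ N = 1) :
    IsIdempotentElem (powAverage N U) := by
  have hN' : (N : ℂ) ≠ 0 := Nat.cast_ne_zero.2 hN
  rw [IsIdempotentElem]
  nth_rw 1 [powAverage]
  rw [smul_mul_assoc, Finset.sum_mul, Finset.sum_congr rfl fun j _ => pow_mul_powAverage hU j,
    Finset.sum_const, Finset.card_range, ← Nat.cast_smul_eq_nsmul ℂ, inv_smul_smul₀ hN']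

theorem sum_powAverage_smul (hN : N ≠ 0) {ζ : ℂ} (hζ : IsPrimitiveRoot ζ N) (T : A) :
    ∑ k ∈ Finset.range N, powAverage N (ζ ^ k • T) = 1 := by
  have hN' : (N : ℂ) ≠ 0 := Nat.cast_ne_zero.2 hN
  simp only [powAverage, ← Finset.smul_sum, smul_pow]
  rw [Finset.sum_comm, Finset.sum_eq_single_of_mem 0 (by simpa [Nat.pos_iff_ne_zero] using hN)]
  · simp [← Nat.cast_smul_eq_nsmul ℂ, hN']
  · intro j hj hj0
    rw [← Finset.sum_smul]
    convert zero_smul ℂ (T ^ j)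
    have hne : ζ ^ j ≠ 1 := hζ.pow_ne_one_of_pos_of_lt hj0 (Finset.mem_range.1 hj)
    simp only [pow_right_comm ζ _ j]
    refine (mul_eq_zero.1 (geom_sum_mul (ζ ^ j) N ▸ ?_)).resolve_right (sub_ne_zero.2 hne)
    rw [pow_right_comm, hζ.pow_eq_one, one_pow, sub_self]

end powAverage

/-- The traces of the powers of an operator of finite order are the power sums of its
eigenvalues, which are roots of unity. -/
theorem LinearMap.exists_trace_pow_eq_sum {V : Type*} [AddCommGroup V] [Module ℂ V]
    [FiniteDimensional ℂ V] {N : ℕ} (hN : N ≠ 0) {ζ : ℂ} (hζ : IsPrimitiveRoot ζ N)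
    {T : Module.End ℂ V} (hT : T ^ N = 1) :
    ∃ d : ℕ → ℕ, ∀ m, LinearMap.trace ℂ V (T ^ m) =
      ∑ k ∈ Finset.range N, d k * (ζ⁻¹ ^ k) ^ m := by
  have hU : ∀ k, (ζ ^ k • T) ^ N = 1 := fun k => by
    rw [smul_pow, hT, pow_right_comm, hζ.pow_eq_one, one_pow, one_smul]
  refine ⟨fun k => Module.finrank ℂ (LinearMap.range (powAverage N (ζ ^ k • T))), fun m => ?_⟩
  rw [← mul_one (T ^ m), ← sum_powAverage_smul hN hζ T, Finset.mul_sum, map_sum]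
  refine Finset.sum_congr rfl fun k _ => ?_
  have hz : ζ ^ k ≠ 0 := pow_ne_zero _ (hζ.ne_zero hN)
  have h := pow_mul_powAverage (hU k) m
  rw [smul_pow, smul_mul_assoc] at h
  rw [← (LinearMap.IsIdempotentElem.isProj_range _ (isIdempotentElem_powAverage hN (hU k))).trace,
    inv_pow, inv_pow]
  nth_rw 2 [← h]
  rw [map_smul, smul_eq_mul, mul_right_comm, mul_inv_cancel₀ (pow_ne_zero _ hz), one_mul]

/-- The trace of the operator permuting the coordinates of `ι → ℂ` along `π` is the number of
fixed points of `π`. -/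
theorem LinearMap.trace_funLeft {ι : Type*} [Fintype ι] [DecidableEq ι] (π : ι → ι) :
    LinearMap.trace ℂ (ι → ℂ) (LinearMap.funLeft ℂ ℂ π) =
      (Finset.univ.filter fun x => π x = x).card := by
  rw [LinearMap.trace_eq_matrix_trace ℂ (Pi.basisFun ℂ ι), Matrix.trace, Finset.card_filter,
    Nat.cast_sum]
  refine Finset.sum_congr rfl fun x _ => ?_
  simp [LinearMap.funLeft_apply, Pi.single_apply]

/-- The right regular representation of `G` on complex-valued functions. -/
noncomputable def rightRegular (G : Type) [Group G] : Representation ℂ G (G → ℂ) where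
  toFun a := LinearMap.funLeft ℂ ℂ (· * a)
  map_one' := by ext; simp [LinearMap.funLeft]
  map_mul' a b := by ext; simp [LinearMap.funLeft, mul_assoc]

theorem funLeft_pow_apply {G : Type} [Group G] (a : G) (j : ℕ) (f : G → ℂ) (x : G) :
    (LinearMap.funLeft ℂ ℂ (a * ·) ^ j : Module.End ℂ (G → ℂ)) f x = f (a ^ j * x) := by
  induction j generalizing f with
  | zero => simp
  | succ j ih => rw [pow_succ, Module.End.mul_apply, ih, LinearMap.funLeft_apply, ← mul_assoc,
      ← pow_succ']

/-- The character of the representation of `G` induced from the linear character of the cyclic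
group generated by `g` that takes the value `η` at `g`, evaluated at `g`. -/
theorem induced_character_mem_charFieldAt {G : Type} [Group G] [Fintype G] [DecidableEq G]
    {g : G} {η : ℂ} (hη : η ^ orderOf g = 1) :
    ((orderOf g : ℂ)⁻¹ * ∑ j ∈ Finset.range (orderOf g),
      η ^ j * (Finset.univ.filter fun x : G => x * g * x⁻¹ = g ^ j).card) ∈
        charFieldAt G (orderOf g) := by
  set N := orderOf g with hN
  have hN0 : N ≠ 0 := (orderOf_pos g).ne'
  let T : Module.End ℂ (G → ℂ) := LinearMap.funLeft ℂ ℂ (g⁻¹ * ·)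
  have hTN : (η • T) ^ N = 1 := by
    rw [smul_pow, hη, one_smul]
    ext f x
    simp [T, funLeft_pow_apply, hN]
  have hcomm : ∀ a, Commute (rightRegular G a) (powAverage N (η • T)) := by
    intro a
    refine ((Commute.sum_right _ _ _ fun j _ => ?_).smul_right _)
    refine Commute.pow_right (Commute.smul_right ?_ _) _
    refine LinearMap.ext fun f => funext fun x => ?_
    simp [rightRegular, T, LinearMap.funLeft_apply, mul_assoc]
  have hidem := isIdempotentElem_powAverage hN0 hTN
  let W : Subrepresentation (rightRegular G) :=
    { toSubmodule := LinearMap.range (powAverage N (η • T))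
      apply_mem_toSubmodule := by
        rintro a _ ⟨v, rfl⟩
        exact ⟨rightRegular G a v, (LinearMap.congr_fun (hcomm a) v).symm⟩ }
  have hW : ∀ x, (rightRegular G g * powAverage N (η • T)) x ∈ W.toSubmodule :=
    fun x => W.apply_mem_toSubmodule g (LinearMap.mem_range_self _ x)
  have hrestrict : W.toRepresentation g =
      (rightRegular G g * powAverage N (η • T)).restrict (fun x _ => hW x) := by
    refine LinearMap.ext fun ⟨x, hx⟩ => Subtype.ext ?_
    obtain ⟨v, rfl⟩ := hx
    exact congrArg (rightRegular G g) (LinearMap.congr_fun hidem v).symm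
  have htrace : W.toRepresentation.character g =
      LinearMap.trace ℂ (G → ℂ) (rightRegular G g * powAverage N (η • T)) := by
    rw [Representation.character, hrestrict]
    exact LinearMap.trace_restrict_eq_of_forall_mem _ _ hW
  convert W.toRepresentation.character_mem_charFieldAt hN.symm using 1
  rw [htrace, powAverage, mul_smul_comm, map_smul, smul_eq_mul,
    Finset.mul_sum _ _ (rightRegular G g), map_sum]
  congr 1
  refine Finset.sum_congr rfl fun j _ => ?_
  have hprod : rightRegular G g * T ^ j = LinearMap.funLeft ℂ ℂ (fun x => g⁻¹ ^ j * (x * g)) := by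
    refine LinearMap.ext fun f => funext fun x => ?_
    simp [rightRegular, T, LinearMap.funLeft_apply, funLeft_pow_apply]
  rw [smul_pow, mul_smul_comm, map_smul, smul_eq_mul, hprod, LinearMap.trace_funLeft]
  congr 4
  ext x
  rw [inv_pow, inv_mul_eq_iff_eq_mul, mul_inv_eq_iff_eq_mul]

namespace Matrix

/-- A non-scalar `2 × 2` matrix over a field is similar to the companion matrix of its
characteristic polynomial. -/
theorem exists_mul_eq_mul_companion {F : Type*} [Field F] {A : Matrix (Fin 2) (Fin 2) F}
    (hA : ∀ c : F, A ≠ c • 1) :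
    ∃ P : Matrix (Fin 2) (Fin 2) F, P.det ≠ 0 ∧ A * P = P * !![0, -A.det; 1, A.trace] := by
  suffices h : ∃ x y : F,
      x * (A 1 0 * x + A 1 1 * y) - (A 0 0 * x + A 0 1 * y) * y ≠ 0 by
    obtain ⟨x, y, h⟩ := h
    refine ⟨!![x, A 0 0 * x + A 0 1 * y; y, A 1 0 * x + A 1 1 * y], by simpa [det_fin_two], ?_⟩
    ext i j
    fin_cases i <;> fin_cases j <;>
      simp [mul_apply, Fin.sum_univ_two, det_fin_two, trace_fin_two] <;> ring
  by_contra! h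
  have h10 : A 1 0 = 0 := by simpa using h 1 0
  have h01 : A 0 1 = 0 := by simpa using h 0 1
  have h11 : A 1 1 = A 0 0 := by simpa [h10, h01, sub_eq_zero] using h 1 1
  refine hA (A 0 0) ?_
  ext i j
  fin_cases i <;> fin_cases j <;> simp [h10, h01, h11]

namespace GeneralLinearGroup

/-- Two non-scalar elements of `GL₂` of a field with the same characteristic polynomial are
conjugate. -/
theorem isConj_of_charpoly_eq {F : Type*} [Field F] {g h : GL (Fin 2) F}
    (hg : ∀ c : F, g.1 ≠ c • 1) (hh : ∀ c : F, h.1 ≠ c • 1)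
    (hgh : g.1.charpoly = h.1.charpoly) : IsConj g h := by
  have htr : g.1.trace = h.1.trace := by
    rw [trace_eq_neg_charpoly_coeff, trace_eq_neg_charpoly_coeff, hgh]
  have hdet : g.1.det = h.1.det := by
    rw [det_eq_sign_charpoly_coeff, det_eq_sign_charpoly_coeff, hgh]
  obtain ⟨P, hP, hgP⟩ := exists_mul_eq_mul_companion hg
  obtain ⟨Q, hQ, hhQ⟩ := exists_mul_eq_mul_companion hh
  let p : GL (Fin 2) F := mkOfDetNeZero P hP
  let q : GL (Fin 2) F := mkOfDetNeZero Q hQ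
  have hpq : p⁻¹ * g * p = q⁻¹ * h * q := by
    refine Units.ext ?_
    have h1 : g.1 * p.1 = p.1 * !![0, -g.1.det; 1, g.1.trace] := hgP
    have h2 : h.1 * q.1 = q.1 * !![0, -g.1.det; 1, g.1.trace] := by rw [htr, hdet]; exact hhQ
    rw [Units.val_mul, Units.val_mul, Units.val_mul, Units.val_mul, mul_assoc, mul_assoc, h1, h2,
      Units.inv_mul_cancel_left, Units.inv_mul_cancel_left]
  refine isConj_iff.2 ⟨q * p⁻¹, ?_⟩
  calc q * p⁻¹ * g * (q * p⁻¹)⁻¹ = q * (p⁻¹ * g * p) * q⁻¹ := by group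
    _ = h := by rw [hpq]; group

section FiniteField

variable {F : Type*} [Field F] [Fintype F]

theorem ne_smul_one_of_not_dvd {g : GL (Fin 2) F} (hg : ¬ orderOf g ∣ Fintype.card F - 1) (c : F) :
    g.1 ≠ c • 1 := by
  intro h
  have hc : c ≠ 0 := by
    rintro rfl
    exact g.ne_zero (by rw [h, zero_smul])
  refine hg (orderOf_dvd_of_pow_eq_one (Units.ext ?_))
  rw [Units.val_pow_eq_pow_val, h, smul_pow, FiniteField.pow_card_sub_one_eq_one c hc, one_pow,
    one_smul, Units.val_one]

/-- If the order of `g ∈ GL₂(𝔽_q)` divides `q ^ 2 - 1` but not `q - 1`, then `g` is conjugate to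
its Frobenius power `g ^ q`. -/
theorem isConj_pow_card {g : GL (Fin 2) F} (hg : ¬ orderOf g ∣ Fintype.card F - 1)
    (hg2 : Fintype.card F ^ 2 ≡ 1 [MOD orderOf g]) : IsConj g (g ^ Fintype.card F) := by
  classical
  have hns := ne_smul_one_of_not_dvd hg
  refine isConj_of_charpoly_eq hns (fun c hc => hns (c ^ Fintype.card F) ?_) ?_
  · rw [← one_pow (M := Matrix (Fin 2) (Fin 2) F) (Fintype.card F), ← smul_pow, ← hc,
      ← Units.val_pow_eq_pow_val, ← pow_mul, ← sq, pow_eq_pow_iff_modEq.2 hg2, pow_one]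
  · rw [Units.val_pow_eq_pow_val, FiniteField.Matrix.charpoly_pow_card]

/-- An element of `GL₂(𝔽_q)` whose order is a power of two not dividing `q - 1`, with `q` odd,
has `-1` as a power. -/
theorem pow_eq_neg_one {r : ℕ} (h2 : (2 : F) ≠ 0) {g : GL (Fin 2) F}
    (hg : orderOf g = 2 ^ (r + 1)) (hgF : ¬ orderOf g ∣ Fintype.card F - 1) :
    g.1 ^ 2 ^ r = -1 := by
  classical
  have hdet : (g.1 ^ 2 ^ r).det = 1 := by
    have h1 : (g.det : Fˣ) ^ 2 ^ (r + 1) = 1 := by rw [← map_pow, ← hg, pow_orderOf_eq_one, map_one]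
    obtain ⟨s, hs, hs'⟩ := (Nat.dvd_prime_pow Nat.prime_two).1 (orderOf_dvd_of_pow_eq_one h1)
    have hsr : s ≤ r := by
      rcases hs.lt_or_eq with h | rfl
      · omega
      · refine absurd ?_ hgF
        rw [hg, ← hs', ← Fintype.card_units]
        exact orderOf_dvd_card
    have h3 : (g.det : Fˣ) ^ 2 ^ r = 1 :=
      orderOf_dvd_iff_pow_eq_one.1 (hs' ▸ pow_dvd_pow 2 hsr)
    rw [det_pow]
    exact congrArg Units.val h3
  have hsq : (g.1 ^ 2 ^ r) * (g.1 ^ 2 ^ r) = 1 := by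
    rw [← pow_add, ← two_mul, ← pow_succ', ← hg, ← Units.val_pow_eq_pow_val, pow_orderOf_eq_one,
      Units.val_one]
  have hne : g.1 ^ 2 ^ r ≠ 1 := by
    intro h
    have h' : g ^ 2 ^ r = 1 := Units.ext (by rw [Units.val_pow_eq_pow_val, h, Units.val_one])
    have := Nat.le_of_dvd (by positivity) (orderOf_dvd_of_pow_eq_one h')
    rw [hg, pow_succ] at this
    have : 0 < 2 ^ r := by positivity
    omega
  generalize g.1 ^ 2 ^ r = h at hdet hsq hne
  have e00 := congrFun (congrFun hsq 0) 0
  have e01 := congrFun (congrFun hsq 0) 1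
  have e10 := congrFun (congrFun hsq 1) 0
  simp only [mul_apply, Fin.sum_univ_two, one_apply_eq, ne_eq, zero_ne_one, one_ne_zero,
    not_false_eq_true, one_apply_ne] at e00 e01 e10
  rw [det_fin_two] at hdet
  have ht : h 0 0 + h 1 1 ≠ 0 := by
    intro ht
    refine h2 ?_
    linear_combination h 0 0 * ht - e00 - hdet
  have h01 : h 0 1 = 0 := (mul_eq_zero.1 (by linear_combination e01)).resolve_right ht
  have h10 : h 1 0 = 0 := (mul_eq_zero.1 (by linear_combination e10)).resolve_right ht
  have hd : h 0 0 = h 1 1 := by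
    rw [h01, zero_mul, add_zero] at e00
    rw [h01, zero_mul, sub_zero] at hdet
    linear_combination h 1 1 * e00 - h 0 0 * hdet
  have hm : h 0 0 = -1 := by
    have : (h 0 0 - 1) * (h 0 0 + 1) = 0 := by
      rw [h01, zero_mul, add_zero] at e00
      linear_combination e00
    refine eq_neg_of_add_eq_zero_left ((mul_eq_zero.1 this).resolve_left fun h00 => hne ?_)
    ext i j
    fin_cases i <;> fin_cases j <;> simp [h10, h01, ← hd, sub_eq_zero.1 h00]
  ext i j
  fin_cases i <;> fin_cases j <;> simp [h10, h01, ← hd, hm]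

/-- For `q` odd, let `g ∈ GL₂(𝔽_q)` have order a power of two not dividing `q - 1`. The only
powers of `g` conjugate to `g` are `g` and `g ^ q`. -/
theorem modEq_of_isConj_pow {r : ℕ} (h2 : (2 : F) ≠ 0) {g : GL (Fin 2) F}
    (hg : orderOf g = 2 ^ (r + 1)) (hgF : ¬ orderOf g ∣ Fintype.card F - 1) {j : ℕ}
    (hj : IsConj g (g ^ j)) :
    j ≡ 1 [MOD orderOf g] ∨ j ≡ Fintype.card F [MOD orderOf g] := by
  classical
  let E := AlgebraicClosure F
  have hE2 : (1 : E) ≠ -1 := by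
    intro h
    apply h2
    apply (algebraMap F E).injective
    rw [map_ofNat, map_zero]
    linear_combination h
  let φ := (algebraMap F E).mapMatrix (m := Fin 2)
  obtain ⟨μ, hμ⟩ := spectrum.nonempty_of_isAlgClosed_of_finiteDimensional E (φ g.1)
  have hord : orderOf μ = orderOf g := by
    rw [hg]
    have h1 : μ ^ 2 ^ r = -1 := by
      have := spectrum.pow_mem_pow (φ g.1) (2 ^ r) hμ
      rw [← map_pow, pow_eq_neg_one h2 hg hgF, map_neg, map_one,
        ← map_one (algebraMap E (Matrix (Fin 2) (Fin 2) E)), ← map_neg, spectrum.scalar_eq] at this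
      exact this
    refine orderOf_eq_prime_pow (p := 2) (by rw [h1]; exact hE2.symm) ?_
    rw [pow_succ, pow_mul, h1, neg_one_sq]
  have hpow : ∀ a b : ℕ, μ ^ a = μ ^ b ↔ a ≡ b [MOD orderOf g] := by
    have hμ0 : μ ≠ 0 := by
      rintro rfl
      rw [orderOf_zero, hg] at hord
      have : 0 < 2 ^ r := by positivity
      omega
    intro a b
    have := pow_eq_pow_iff_modEq (x := Units.mk0 μ hμ0) (n := a) (m := b)
    rwa [← orderOf_units, Units.val_mk0, hord, Units.ext_iff] at this
  have hroot : ∀ k : ℕ, (g.1 ^ k).charpoly = g.1.charpoly →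
      μ ^ k ∈ (φ g.1).charpoly.roots := by
    intro k hk
    have := spectrum.pow_mem_pow (φ g.1) k hμ
    rw [mem_spectrum_iff_isRoot_charpoly, ← map_pow, RingHom.mapMatrix_apply, charpoly_map, hk,
      ← charpoly_map] at this
    exact (Polynomial.mem_roots (charpoly_monic _).ne_zero).2 this
  have hjc : (g.1 ^ j).charpoly = g.1.charpoly := by
    obtain ⟨c, hc⟩ := isConj_iff.1 hj
    rw [← Units.val_pow_eq_pow_val, ← hc, Units.val_mul, Units.val_mul, coe_units_inv,
      charpoly_units_conj]
  have hmem1 := hroot 1 (by rw [pow_one])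
  have hmemq := hroot _ (FiniteField.Matrix.charpoly_pow_card g.1)
  have hmemj := hroot j hjc
  have hne : μ ^ 1 ≠ μ ^ Fintype.card F := by
    rw [Ne, hpow, Nat.modEq_iff_dvd' Fintype.card_pos]
    exact hgF
  rw [← hpow, ← hpow]
  by_contra! h
  have hcard : ({μ ^ j, μ ^ 1, μ ^ Fintype.card F} : Finset E).card ≤
      (φ g.1).charpoly.roots.toFinset.card := by
    refine Finset.card_le_card ?_
    simp only [Finset.insert_subset_iff, Finset.singleton_subset_iff, Multiset.mem_toFinset]
    exact ⟨hmemj, hmem1, hmemq⟩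
  rw [Finset.card_eq_three.2 ⟨_, _, _, h.1, h.2, hne, rfl⟩] at hcard
  have := hcard.trans ((Multiset.toFinset_card_le _).trans (Polynomial.card_roots' _))
  rw [charpoly_natDegree_eq_dim, Fintype.card_fin] at this
  omega

end FiniteField

end GeneralLinearGroup

end Matrix

theorem isPrimitiveRoot_zeta {N : ℕ} (hN : N ≠ 0) : IsPrimitiveRoot (zeta N) N :=
  Complex.isPrimitiveRoot_exp N hN

/-- For `q` odd, the field generated by the character values of `GL₂(𝔽_q)` at elements whose order
`N` is a power of two dividing `q ^ 2 - 1` but not `q - 1` is generated by the sums `η + η ^ q` with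
`η` an `N`-th root of unity. -/
theorem charFieldAt_GL_two {F : Type} [Field F] [Fintype F] {r : ℕ} (h2 : (2 : F) ≠ 0)
    (hex : ∃ g : GL (Fin 2) F, orderOf g = 2 ^ (r + 1))
    (hF : ¬ 2 ^ (r + 1) ∣ Fintype.card F - 1)
    (hF2 : Fintype.card F ^ 2 ≡ 1 [MOD 2 ^ (r + 1)]) :
    charFieldAt (GL (Fin 2) F) (2 ^ (r + 1)) =
      IntermediateField.adjoin ℚ
        {x : ℂ | ∃ η : ℂ, η ^ 2 ^ (r + 1) = 1 ∧ η + η ^ Fintype.card F = x} := by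
  classical
  apply le_antisymm
  · rw [charFieldAt, IntermediateField.adjoin_le_iff]
    rintro _ ⟨V, -, g, hg, rfl⟩
    obtain ⟨y, hy⟩ := isConj_iff.1
      (Matrix.GeneralLinearGroup.isConj_pow_card (hg ▸ hF) (hg ▸ hF2))
    have hζ : IsPrimitiveRoot (zeta (2 ^ (r + 1))) (2 ^ (r + 1)) :=
      isPrimitiveRoot_zeta (by positivity)
    obtain ⟨d, hd⟩ := LinearMap.exists_trace_pow_eq_sum (by positivity) hζ (T := V.ρ g)
      (by rw [← map_pow, ← hg, pow_orderOf_eq_one, map_one])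
    have hchar : ∀ m, V.character (g ^ m) = LinearMap.trace ℂ V (V.ρ g ^ m) := fun m => by
      rw [FDRep.character, map_pow]
    have hq := hchar (Fintype.card F)
    rw [← hy, FDRep.char_conj, hd] at hq
    have h1 := hchar 1
    rw [pow_one, hd] at h1
    have hsum : V.character g = 2⁻¹ * ∑ k ∈ Finset.range (2 ^ (r + 1)),
        d k * ((zeta (2 ^ (r + 1)))⁻¹ ^ k + ((zeta (2 ^ (r + 1)))⁻¹ ^ k) ^ Fintype.card F) := by
      simp only [mul_add, Finset.sum_add_distrib]
      rw [← hq]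
      simp only [pow_one] at h1
      rw [← h1]
      ring
    rw [SetLike.mem_coe, hsum]
    refine mul_mem (inv_mem (ofNat_mem _ 2)) (sum_mem fun k _ => mul_mem (natCast_mem _ _)
      (IntermediateField.subset_adjoin _ _ ⟨_, ?_, rfl⟩))
    rw [pow_right_comm, hζ.inv.pow_eq_one, one_pow]
  · rw [IntermediateField.adjoin_le_iff]
    rintro _ ⟨η, hη, rfl⟩
    obtain ⟨g, hg⟩ := hex
    obtain ⟨y, hy⟩ := isConj_iff.1
      (Matrix.GeneralLinearGroup.isConj_pow_card (hg ▸ hF) (hg ▸ hF2))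
    have hmem := induced_character_mem_charFieldAt (g := g) (η := η) (by rw [hg, hη])
    set N := 2 ^ (r + 1)
    have hN1 : 1 < N := Nat.one_lt_two_pow (by omega)
    set q := Fintype.card F with hq
    set c : ℕ → ℕ := fun j => (Finset.univ.filter fun x : GL (Fin 2) F =>
      x * g * x⁻¹ = g ^ j).card
    have hgq : g ^ (q % N) = g ^ q := by rw [← hg, pow_mod_orderOf]
    have hcq : c (q % N) = c 1 := by
      refine (Finset.card_equiv (Equiv.mulLeft y) fun x => ?_).symm
      have : y * x * g * (y * x)⁻¹ = y * (x * g * x⁻¹) * y⁻¹ := by group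
      simp only [Finset.mem_filter, Finset.mem_univ, true_and, Equiv.coe_mulLeft, pow_one]
      rw [this, hgq, ← hy, mul_left_inj, mul_right_inj]
    have hc1 : c 1 ≠ 0 := (Finset.card_pos.2 ⟨1, by simp⟩).ne'
    have hne : 1 ≠ q % N := by
      intro h
      refine hF ((Nat.modEq_iff_dvd' Fintype.card_pos).1 ?_)
      rw [Nat.ModEq, Nat.mod_eq_of_lt hN1, ← hq, ← h]
    have hsum : ∑ j ∈ Finset.range N, η ^ j * (c j : ℂ) = c 1 * (η + η ^ q) := by
      rw [← Finset.sum_subset (s₁ := {1, q % N}), Finset.sum_pair hne, hcq, pow_one,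
        ← pow_eq_pow_mod q hη]
      · ring
      · simp [Finset.insert_subset_iff, hN1, Nat.mod_lt _ (zero_lt_one.trans hN1)]
      · intro j hj hj'
        rw [Finset.mem_range] at hj
        rw [mul_eq_zero, Nat.cast_eq_zero, Finset.card_eq_zero, Finset.filter_eq_empty_iff]
        refine Or.inr fun x _ hx => hj' ?_
        have := Matrix.GeneralLinearGroup.modEq_of_isConj_pow h2 hg (hg ▸ hF)
          (isConj_iff.2 ⟨x, hx⟩)
        rw [hg, Nat.ModEq, Nat.ModEq, Nat.mod_eq_of_lt hj, Nat.mod_eq_of_lt hN1] at this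
        simpa using this
    rw [hg, hsum] at hmem
    have hN0 : (N : ℂ) ≠ 0 := Nat.cast_ne_zero.2 (zero_lt_one.trans hN1).ne'
    have hc0 : (c 1 : ℂ) ≠ 0 := Nat.cast_ne_zero.2 hc1
    have hres : η + η ^ q = N * (c 1 : ℂ)⁻¹ * ((N : ℂ)⁻¹ * (c 1 * (η + η ^ q))) := by
      field_simp
    rw [SetLike.mem_coe, hres]
    exact mul_mem (mul_mem (natCast_mem _ _) (inv_mem (natCast_mem _ _))) hmem

theorem IntermediateField.pow_add_pow_mem {K L : Type*} [Field K] [Field L] [Algebra K L]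
    (S : IntermediateField K L) {a b : L} (hadd : a + b ∈ S) (hmul : a * b ∈ S) (k : ℕ) :
    a ^ k + b ^ k ∈ S := by
  induction k using Nat.strong_induction_on with
  | _ k ih =>
  match k with
  | 0 => simpa using add_mem (one_mem S) (one_mem S)
  | 1 => simpa using hadd
  | k + 2 =>
    have h : a ^ (k + 2) + b ^ (k + 2) =
        (a + b) * (a ^ (k + 1) + b ^ (k + 1)) - a * b * (a ^ k + b ^ k) := by ring
    rw [h]
    exact sub_mem (mul_mem hadd (ih _ (by omega))) (mul_mem hmul (ih _ (by omega)))

theorem zeta_mul_pow {M N : ℕ} (hM : M ≠ 0) : zeta (N * M) ^ M = zeta N := by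
  rw [zeta, zeta, ← Complex.exp_nat_mul]
  congr 1
  push_cast
  have : (M : ℂ) ≠ 0 := Nat.cast_ne_zero.2 hM
  field_simp

theorem zeta_mul_two_pow {N : ℕ} (hN : N ≠ 0) : zeta (N * 2) ^ N = -1 :=
  (isPrimitiveRoot_zeta two_ne_zero).eq_neg_one_of_two_right ▸ mul_comm N 2 ▸ zeta_mul_pow hN

/-- For `p` odd, `r ≥ 3`, and `GL_2(F_q)` containing an element of order
`2^r`: if `q ≡ 2^{r−1} − 1 (mod 2^r)` then
`K_{2^r}(GL_2(F_q)) = ℚ(ζ_{2^{r−1}} + ζ_{2^{r−1}}^{−1}, ζ_{2^r} − ζ_{2^r}^{−1})`; if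
`q ≡ 2^{r−1} + 1 (mod 2^r)` then `K_{2^r}(GL_2(F_q)) = ℚ(ζ_{2^{r−1}})`. -/
theorem statement18 (p n q r : ℕ) (hp : p.Prime) (hodd : Odd p) (hn : 1 ≤ n)
    (hq : q = p ^ n) (hr : 3 ≤ r)
    (F : Type) [Field F] [Fintype F] (hF : Fintype.card F = q)
    (hex : ∃ g : GL (Fin 2) F, orderOf g = 2 ^ r) :
    ((q : ZMod (2 ^ r)) = (2 ^ (r - 1) : ℕ) - 1 →
      charFieldAt (GL (Fin 2) F) (2 ^ r) =
        IntermediateField.adjoin ℚ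
          {zeta (2 ^ (r - 1)) + (zeta (2 ^ (r - 1)))⁻¹,
            zeta (2 ^ r) - (zeta (2 ^ r))⁻¹}) ∧
    ((q : ZMod (2 ^ r)) = (2 ^ (r - 1) : ℕ) + 1 →
      charFieldAt (GL (Fin 2) F) (2 ^ r) =
        IntermediateField.adjoin ℚ {zeta (2 ^ (r - 1))}) := by
  have h2 : (2 : F) ≠ 0 := by
    intro h
    have hqodd : Odd q := hq ▸ hodd.pow
    have hq0 : ((q : ℕ) : F) = 0 := hF ▸ FiniteField.cast_card_eq_zero F
    obtain ⟨m, hm⟩ := hqodd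
    rw [hm, Nat.cast_add, Nat.cast_mul, Nat.cast_ofNat, h, zero_mul, zero_add, Nat.cast_one] at hq0
    exact one_ne_zero hq0
  obtain ⟨s, rfl⟩ : ∃ s, r = s + 2 + 1 := ⟨r - 3, by omega⟩
  rw [Nat.add_sub_cancel]
  have hz2 : zeta (2 ^ (s + 2)) = zeta (2 ^ (s + 2 + 1)) ^ 2 := by
    rw [pow_succ 2 (s + 2), zeta_mul_pow two_ne_zero]
  have hzN : zeta (2 ^ (s + 2 + 1)) ^ 2 ^ (s + 2) = -1 := by
    rw [pow_succ 2 (s + 2), zeta_mul_two_pow (by positivity)]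
  have hprim : IsPrimitiveRoot (zeta (2 ^ (s + 2 + 1))) (2 ^ (s + 2 + 1)) :=
    isPrimitiveRoot_zeta (by positivity)
  have hpow1 := hprim.pow_eq_one
  have hz0 : zeta (2 ^ (s + 2 + 1)) ≠ 0 := hprim.ne_zero (by positivity)
  have hroots : ∀ η : ℂ, η ^ 2 ^ (s + 2 + 1) = 1 → ∃ k, zeta (2 ^ (s + 2 + 1)) ^ k = η := by
    intro η hη
    have : NeZero (2 ^ (s + 2 + 1)) := ⟨by positivity⟩
    obtain ⟨k, -, hk⟩ := hprim.eq_pow_of_pow_eq_one hη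
    exact ⟨k, hk⟩
  rw [hz2]
  generalize zeta (2 ^ (s + 2 + 1)) = ζ at hzN hpow1 hroots hz0
  have hN : 2 ^ (s + 2 + 1) = 8 * 2 ^ s := by ring
  have hM : 2 ^ (s + 2) = 4 * 2 ^ s := by ring
  have ht : 0 < 2 ^ s := by positivity
  have hηpow : (ζ ^ 2) ^ 2 ^ (s + 2 + 1) = 1 := by rw [pow_right_comm, hpow1, one_pow]
  constructor
  · intro hmod
    have hmod' : q + 1 ≡ 2 ^ (s + 2) [MOD 2 ^ (s + 2 + 1)] := by
      rw [← ZMod.natCast_eq_natCast_iff, Nat.cast_add, hmod, Nat.cast_one, sub_add_cancel]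
    obtain ⟨m, hm⟩ : ∃ m, q + 1 = 2 ^ (s + 2) + 2 ^ (s + 2 + 1) * m := by
      refine ⟨(q + 1) / 2 ^ (s + 2 + 1), ?_⟩
      rw [Nat.ModEq, Nat.mod_eq_of_lt (a := 2 ^ (s + 2)) (by omega)] at hmod'
      rw [← hmod', Nat.mod_add_div]
    have hζq : ζ ^ q = -ζ⁻¹ := by
      rw [eq_neg_iff_add_eq_zero, ← mul_left_inj' hz0, add_mul, ← pow_succ, hm, pow_add, pow_mul,
        hpow1, hzN, inv_mul_cancel₀ hz0]
      ring
    rw [charFieldAt_GL_two h2 hex, hF]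
    · apply le_antisymm <;> rw [IntermediateField.adjoin_le_iff]
      · rintro _ ⟨η, hη, rfl⟩
        obtain ⟨k, rfl⟩ := hroots η hη
        rw [pow_right_comm, hζq]
        refine IntermediateField.pow_add_pow_mem _ ?_ ?_ k
        · rw [← sub_eq_add_neg]
          exact IntermediateField.subset_adjoin _ _ (Or.inr rfl)
        · rw [mul_neg, mul_inv_cancel₀ hz0]
          exact neg_mem (one_mem _)
      · rintro _ (rfl | rfl)
        · refine IntermediateField.subset_adjoin _ _ ⟨ζ ^ 2, hηpow, ?_⟩
          rw [pow_right_comm, hζq, neg_sq, inv_pow]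
        · exact IntermediateField.subset_adjoin _ _ ⟨ζ, hpow1, by rw [hζq, sub_eq_add_neg]⟩
    · rintro ⟨c, hc⟩
      rw [hF, hN, mul_assoc] at hc
      rw [hN, hM, mul_assoc] at hm
      omega
    · rw [hF, ← Int.natCast_modEq_iff, Int.modEq_iff_dvd]
      refine ⟨(1 + 2 * m) * (1 - 2 ^ (s + 1) * (1 + 2 * m)), ?_⟩
      have hm' : (q : ℤ) = 4 * 2 ^ s + 8 * 2 ^ s * m - 1 := by
        rw [hN, hM] at hm
        rw [eq_sub_iff_add_eq]
        exact_mod_cast hm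
      push_cast
      rw [hm']
      ring
  · intro hmod
    have hmod' : q ≡ 2 ^ (s + 2) + 1 [MOD 2 ^ (s + 2 + 1)] := by
      rw [← ZMod.natCast_eq_natCast_iff, hmod, Nat.cast_add, Nat.cast_one]
    obtain ⟨m, hm⟩ : ∃ m, q = 2 ^ (s + 2) + 1 + 2 ^ (s + 2 + 1) * m := by
      refine ⟨q / 2 ^ (s + 2 + 1), ?_⟩
      rw [Nat.ModEq, Nat.mod_eq_of_lt (a := 2 ^ (s + 2) + 1) (by omega)] at hmod'
      rw [← hmod', Nat.mod_add_div]
    have hζq : ζ ^ q = -ζ := by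
      rw [hm, pow_add, pow_mul, hpow1, pow_succ, hzN]
      ring
    rw [charFieldAt_GL_two h2 hex, hF]
    · apply le_antisymm <;> rw [IntermediateField.adjoin_le_iff]
      · rintro _ ⟨η, hη, rfl⟩
        obtain ⟨k, rfl⟩ := hroots η hη
        rw [pow_right_comm, hζq]
        refine IntermediateField.pow_add_pow_mem _ ?_ ?_ k
        · rw [add_neg_cancel]
          exact zero_mem _
        · rw [mul_neg, ← sq]
          exact neg_mem (IntermediateField.subset_adjoin _ _ rfl)
      · rintro _ rfl
        have hmem : ζ ^ 2 + (ζ ^ 2) ^ q ∈ IntermediateField.adjoin ℚ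
            {x : ℂ | ∃ η : ℂ, η ^ 2 ^ (s + 2 + 1) = 1 ∧ η + η ^ q = x} :=
          IntermediateField.subset_adjoin _ _ ⟨ζ ^ 2, hηpow, rfl⟩
        rw [pow_right_comm, hζq, neg_sq, ← two_mul] at hmem
        have := mul_mem (inv_mem (ofNat_mem _ 2)) hmem
        rwa [inv_mul_cancel_left₀ two_ne_zero] at this
    · rintro ⟨c, hc⟩
      rw [hF, hN, mul_assoc] at hc
      rw [hN, hM, mul_assoc] at hm
      have h : 2 ^ s * (8 * c) = 2 ^ s * (4 + 8 * m) := by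
        linarith [show q = 8 * (2 ^ s * c) + 1 by omega]
      have := Nat.eq_of_mul_eq_mul_left ht h
      omega
    · rw [hF, ← Int.natCast_modEq_iff, Int.modEq_iff_dvd]
      refine ⟨-(1 + 2 * m) * (1 + 2 ^ (s + 1) * (1 + 2 * m)), ?_⟩
      rw [hm]
      push_cast
      ring
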